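/- Let 𝒯 be a geodesic tube of direction β∨. The set consisting of the identity together with all hyperbolic elements of W^aff stabilizing 𝒯 forms a cyclic subgroup of W^aff. Moreover, the hyperbolic stabilizer w_min whose positive coefficient c_w (defined by v_w = c_w β∨) is minimal is a generator of this subgroup. -/

import Mathlib

open scoped RealInnerProductSpace

noncomputable section

/-- The ambient Euclidean space of rank `m`.  Via the fixed `W`-invariant inner product we
identify the space `V` containing the root system with its dual `V*`; the affine space `A`
underlying `V*` is then the Euclidean space itself. -/
abbrev E (m : ℕ) := EuclideanSpace ℝ (Fin m)

variable {m : ℕ}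

/-- The coroot `α∨ = 2α/(α,α)` of a vector `α` (under the identification of `V` with `V*`
given by the invariant inner product). -/
def coroot (α : E m) : E m := (2 / ⟪α, α⟫) • α

/-- The affine reflection `s_{α,k}(x) = x - (⟨α,x⟩ - k) α∨` as a function. -/
def affReflFun (α : E m) (k : ℤ) : E m → E m := fun x => x - (⟪α, x⟫ - (k : ℝ)) • coroot α

lemma affReflFun_involutive (α : E m) (k : ℤ) : Function.Involutive (affReflFun α k) := by
  intro x
  by_cases h : α = 0
  · simp [affReflFun, coroot, h]
  · have hαα : ⟪α, α⟫ ≠ (0:ℝ) := (inner_self_ne_zero (𝕜 := ℝ)).mpr h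
    have h2 : ⟪α, coroot α⟫ = (2:ℝ) := by
      unfold coroot
      rw [real_inner_smul_right, div_mul_cancel₀ _ hαα]
    have key : ∀ y : E m, ∀ s : ℝ, ⟪α, y - s • coroot α⟫ = ⟪α, y⟫ - 2 * s := by
      intro y s
      rw [inner_sub_right, real_inner_smul_right, h2]
      ring
    show affReflFun α k (x - (⟪α, x⟫ - (k:ℝ)) • coroot α) = x
    unfold affReflFun
    rw [key]
    rw [sub_sub, ← add_smul]
    rw [show (⟪α, x⟫ - (k:ℝ)) + (⟪α, x⟫ - 2 * (⟪α, x⟫ - (k:ℝ)) - (k:ℝ)) = 0 by ring]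
    simp

/-- The affine reflection `s_{α,k}` as a permutation of the affine space. -/
def affRefl (α : E m) (k : ℤ) : Equiv.Perm (E m) := (affReflFun_involutive α k).toPerm

/-- The affine Weyl group of a set of roots `Φ`: the group generated by all affine
reflections `s_{α,k}`, `α ∈ Φ`, `k ∈ ℤ`. -/
def Waff (Φ : Set (E m)) : Subgroup (Equiv.Perm (E m)) :=
  Subgroup.closure {w | ∃ α ∈ Φ, ∃ k : ℤ, w = affRefl α k}

/-- `Φ` is a reduced (crystallographic) root system spanning the ambient space. -/
structure IsRootSystem (Φ : Set (E m)) : Prop where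
  finite : Φ.Finite
  ne_zero : ∀ α ∈ Φ, α ≠ (0 : E m)
  span_eq_top : Submodule.span ℝ Φ = ⊤
  reflect_mem : ∀ α ∈ Φ, ∀ β ∈ Φ, β - ⟪α, β⟫ • coroot α ∈ Φ
  crystallographic : ∀ α ∈ Φ, ∀ β ∈ Φ, ∃ z : ℤ, ⟪α, coroot β⟫ = (z : ℝ)
  reduced : ∀ α ∈ Φ, ∀ t : ℝ, t • α ∈ Φ → t = 1 ∨ t = -1

/-- `B` is a system of simple roots of `Φ`. -/
structure IsSimpleSystem (Φ : Set (E m)) (B : Fin m → E m) : Prop where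
  mem : ∀ i, B i ∈ Φ
  indep : LinearIndependent ℝ B
  decomp : ∀ α ∈ Φ, (∃ c : Fin m → ℤ, α = ∑ j, (c j : ℝ) • B j ∧ ∀ j, 0 ≤ c j) ∨
                    (∃ c : Fin m → ℤ, α = ∑ j, (c j : ℝ) • B j ∧ ∀ j, c j ≤ 0)

/-- `ω` is the system of fundamental coweights relative to the simple roots `B`,
i.e. `⟨α_i, ω_j∨⟩ = δ_{ij}`. -/
def IsFundamentalCoweights (B ω : Fin m → E m) : Prop :=
  ∀ i j, ⟪B i, ω j⟫ = if i = j then (1 : ℝ) else 0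

/-- The wall `H_{α,k} = {x : ⟨α,x⟩ = k}`. -/
def wall (α : E m) (k : ℤ) : Set (E m) := {x | ⟪α, x⟫ = (k : ℝ)}

/-- The union of all walls of the root system `Φ`. -/
def allWalls (Φ : Set (E m)) : Set (E m) := ⋃ α ∈ Φ, ⋃ k : ℤ, wall α k

/-- An alcove: a connected component of the complement of the union of all walls. -/
def IsAlcove (Φ : Set (E m)) (C : Set (E m)) : Prop :=
  ∃ x ∈ (allWalls Φ)ᶜ, C = connectedComponentIn (allWalls Φ)ᶜ x

/-- The set `𝒲` of walls removed when forming geodesic tubes of direction `β∨`: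
all walls `H_{α,k}` with `⟨α, β∨⟩ = 0` (equivalently `α ∈ Φ_I`). -/
def tubeWalls (Φ : Set (E m)) (β : E m) : Set (E m) :=
  ⋃ α ∈ {α ∈ Φ | ⟪α, β⟫ = (0:ℝ)}, ⋃ k : ℤ, wall α k

/-- A geodesic tube of direction `β∨`: a connected component of `A ∖ ⋃𝒲`. -/
def IsGeodesicTube (Φ : Set (E m)) (β : E m) (T : Set (E m)) : Prop :=
  ∃ x ∈ (tubeWalls Φ β)ᶜ, T = connectedComponentIn (tubeWalls Φ β)ᶜ x

/-- `d_γ = inf_x d(x, γx)`. -/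
def minDisp (f : E m → E m) : ℝ := ⨅ x, dist x (f x)

/-- `Min(γ) = {x : d(x,γx) = d_γ}`. -/
def minSet (f : E m → E m) : Set (E m) := {x | dist x (f x) = minDisp f}

/-- A hyperbolic isometry: semisimple (`Min` nonempty) with `d_γ > 0`. -/
def IsHyperbolic (f : E m → E m) : Prop := (minSet f).Nonempty ∧ 0 < minDisp f

/-- `v` is the vector by which `γ` translates its min set. -/
def HasTransVec (f : E m → E m) (v : E m) : Prop := ∀ x ∈ minSet f, f x = x + v

/-- `x` is the barycenter of the polysimplex `s`: the average of the vertices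
(extreme points of the closure) of `s`. -/
def IsBarycenter (s : Set (E m)) (x : E m) : Prop :=
  ∃ F : Finset (E m), (F : Set (E m)) = Set.extremePoints ℝ (closure s) ∧ F.Nonempty ∧
    x = (F.card : ℝ)⁻¹ • ∑ y ∈ F, y

/-- The centerline `ℒ = x + ℝ β∨`. -/
def centerline (x β : E m) : Set (E m) := {p | ∃ t : ℝ, p = x + t • β}


/-- `w` is a hyperbolic element of the affine Weyl group stabilizing the tube `T`. -/
def IsHypStab (Φ : Set (E m)) (T : Set (E m)) (w : Equiv.Perm (E m)) : Prop :=
  w ∈ Waff Φ ∧ IsHyperbolic (w : E m → E m) ∧ (w : E m → E m) '' T = T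


lemma perm_inv_app (w : Equiv.Perm (E m)) (p : E m) : w⁻¹ (w p) = p := w.symm_apply_apply p

/-- Value of the affine function of a wall. -/
def phi (α : E m) (k : ℤ) (y : E m) : ℝ := ⟪α, y⟫ - (k : ℝ)

/-- Affine isometries preserving the roots. -/
def GoodWith (Φ : Set (E m)) (w : Equiv.Perm (E m)) (u : E m ≃ₗᵢ[ℝ] E m) : Prop :=
  (∀ x, w x = u x + w 0) ∧ (∀ α, u α ∈ Φ ↔ α ∈ Φ) ∧ ∀ α ∈ Φ, ∃ z : ℤ, ⟪α, w 0⟫ = (z : ℝ)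

lemma affRefl_apply (α : E m) (k : ℤ) (x : E m) :
    affRefl α k x = x - (phi α k x) • coroot α := rfl

lemma affRefl_mul_self (α : E m) (k : ℤ) : affRefl α k * affRefl α k = 1 := by
  ext1 x
  exact affReflFun_involutive α k x

lemma affRefl_inv (α : E m) (k : ℤ) : (affRefl α k)⁻¹ = affRefl α k :=
  inv_eq_of_mul_eq_one_left (affRefl_mul_self α k)

lemma affRefl_mem {Φ : Set (E m)} {α : E m} (hα : α ∈ Φ) (k : ℤ) : affRefl α k ∈ Waff Φ :=
  Subgroup.subset_closure ⟨α, hα, k, rfl⟩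

lemma refl_eq (α x : E m) :
    (Submodule.reflection (ℝ ∙ α)ᗮ) x = x - ⟪α, x⟫ • coroot α := by
  rw [Submodule.reflection_orthogonal_apply, Submodule.reflection_singleton_apply, coroot]
  simp only [RCLike.ofReal_real_eq_id, id]
  rw [neg_sub, smul_smul, ← Nat.cast_smul_eq_nsmul ℝ, smul_smul, real_inner_self_eq_norm_sq]
  congr 2
  push_cast
  ring

lemma good_refl {Φ : Set (E m)} (hΦ : IsRootSystem Φ) {α : E m} (hα : α ∈ Φ) (k : ℤ) :
    ∃ u, GoodWith Φ (affRefl α k) u := by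
  refine ⟨Submodule.reflection (ℝ ∙ α)ᗮ, ?_, ?_, ?_⟩
  · intro x
    rw [refl_eq, affRefl_apply, affRefl_apply, phi, phi, inner_zero_right, sub_smul, sub_smul]
    simp only [zero_smul]
    abel
  · have key : ∀ β ∈ Φ, (Submodule.reflection (ℝ ∙ α)ᗮ) β ∈ Φ := by
      intro β hβ
      rw [refl_eq]
      exact hΦ.reflect_mem α hα β hβ
    intro β
    refine ⟨fun h => ?_, key β⟩
    have := key _ h
    rwa [Submodule.reflection_reflection] at this
  · intro β hβ
    obtain ⟨z, hz⟩ := hΦ.crystallographic β hβ α hα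
    refine ⟨k * z, ?_⟩
    rw [affRefl_apply, phi, inner_zero_right, inner_sub_right, inner_smul_right, hz]
    simp

lemma good_mul {Φ : Set (E m)} {w₁ w₂ : Equiv.Perm (E m)} {u₁ u₂ : E m ≃ₗᵢ[ℝ] E m}
    (h₁ : GoodWith Φ w₁ u₁) (h₂ : GoodWith Φ w₂ u₂) : GoodWith Φ (w₁ * w₂) (u₂.trans u₁) := by
  obtain ⟨a1, b1, c1⟩ := h₁
  obtain ⟨a2, b2, c2⟩ := h₂
  refine ⟨?_, ?_, ?_⟩
  · intro x
    simp only [Equiv.Perm.coe_mul, Function.comp, LinearIsometryEquiv.trans_apply]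
    rw [a1 (w₂ x), a2 x, a1 (w₂ 0), map_add, add_assoc]
  · intro α
    simp only [LinearIsometryEquiv.trans_apply]
    rw [b1, b2]
  · intro α hα
    simp only [Equiv.Perm.coe_mul, Function.comp]
    have h : u₁.symm α ∈ Φ := by rw [← b1]; simpa using hα
    obtain ⟨z, hz⟩ := c1 α hα
    obtain ⟨z', hz'⟩ := c2 _ h
    refine ⟨z' + z, ?_⟩
    have : ⟪α, u₁ (w₂ 0)⟫ = ⟪u₁.symm α, w₂ 0⟫ := by
      rw [← u₁.inner_map_map (u₁.symm α) (w₂ 0), u₁.apply_symm_apply]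
    rw [a1, inner_add_right, hz, this, hz']
    push_cast
    rfl

lemma good_of_mem {Φ : Set (E m)} (hΦ : IsRootSystem Φ) {w : Equiv.Perm (E m)}
    (hw : w ∈ Waff Φ) : ∃ u, GoodWith Φ w u := by
  unfold Waff at hw
  induction hw using Subgroup.closure_induction_left with
  | one =>
    refine ⟨LinearIsometryEquiv.refl ℝ _, ?_, ?_, ?_⟩
    · intro x; simp
    · intro α; simp
    · intro α _; exact ⟨0, by simp⟩
  | mul_left x hx y hy ih =>
    obtain ⟨α, hα, k, rfl⟩ := hx
    obtain ⟨u, hu⟩ := good_refl hΦ hα k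
    obtain ⟨u', hu'⟩ := ih
    exact ⟨_, good_mul hu hu'⟩
  | inv_mul_cancel x hx y hy ih =>
    obtain ⟨α, hα, k, rfl⟩ := hx
    rw [affRefl_inv]
    obtain ⟨u, hu⟩ := good_refl hΦ hα k
    obtain ⟨u', hu'⟩ := ih
    exact ⟨_, good_mul hu hu'⟩

lemma coroot_map (u : E m ≃ₗᵢ[ℝ] E m) (α : E m) : coroot (u α) = u (coroot α) := by
  unfold coroot
  rw [u.inner_map_map, map_smul]

lemma conj_exists {Φ : Set (E m)} (hΦ : IsRootSystem Φ) {w : Equiv.Perm (E m)}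
    (hw : w ∈ Waff Φ) {α : E m} (hα : α ∈ Φ) (k : ℤ) :
    ∃ β ∈ Φ, ∃ l : ℤ, (∀ y, phi β l (w y) = phi α k y) ∧
      affRefl β l = w * affRefl α k * w⁻¹ ∧ ⟪β, β⟫ = ⟪α, α⟫ := by
  obtain ⟨u, a, b, c⟩ := good_of_mem hΦ hw
  obtain ⟨z, hz⟩ := c (u α) ((b α).2 hα)
  have key : ∀ y, phi (u α) (k + z) (w y) = phi α k y := by
    intro y
    unfold phi
    rw [a y, inner_add_right, u.inner_map_map, hz]
    push_cast
    ring
  refine ⟨u α, (b α).2 hα, k + z, key, ?_, u.inner_map_map _ _⟩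
  rw [eq_mul_inv_iff_mul_eq]
  ext1 y
  simp only [Equiv.Perm.coe_mul, Function.comp]
  rw [affRefl_apply, affRefl_apply, key, coroot_map, a (y - _), a y, map_sub, map_smul]
  abel

lemma phi_self {α : E m} (hα : α ≠ 0) (k : ℤ) (y : E m) :
    phi α k (affRefl α k y) = - phi α k y := by
  have hαα : ⟪α, α⟫ ≠ (0:ℝ) := (inner_self_ne_zero (𝕜 := ℝ)).mpr hα
  rw [affRefl_apply]
  unfold phi coroot
  rw [inner_sub_right, inner_smul_right, inner_smul_right]
  field_simp
  ring

/-- Reflections in the walls of the alcove of `p`. -/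
def Sset (Φ : Set (E m)) (p : E m) : Set (Equiv.Perm (E m)) :=
  {s | ∃ α ∈ Φ, ∃ k : ℤ, s = affRefl α k ∧ ∀ β ∈ Φ, ∀ l : ℤ,
    phi β l p * phi β l (s p) < 0 → affRefl β l = s}

/-- `p` lies on no wall. -/
def Regular (Φ : Set (E m)) (p : E m) : Prop := ∀ α ∈ Φ, ∀ k : ℤ, phi α k p ≠ 0

lemma Sset_sub (Φ : Set (E m)) (p : E m) : Sset Φ p ⊆ Waff Φ := by
  rintro s ⟨α, hα, k, rfl, -⟩
  exact affRefl_mem hα k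

lemma regular_map {Φ : Set (E m)} (hΦ : IsRootSystem Φ) {w : Equiv.Perm (E m)}
    (hw : w ∈ Waff Φ) {p : E m} (hp : Regular Φ p) : Regular Φ (w p) := by
  intro α hα k
  obtain ⟨β, hβ, l, h, -⟩ := conj_exists hΦ (inv_mem hw) hα k
  rw [← h, perm_inv_app]
  exact hp β hβ l

lemma list_mem {Φ : Set (E m)} {p : E m} {L : List (Equiv.Perm (E m))}
    (hL : ∀ s ∈ L, s ∈ Sset Φ p) : L.prod ∈ Waff Φ :=
  list_prod_mem fun s hs => Sset_sub Φ p (hL s hs)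

lemma exchange {Φ : Set (E m)} (hΦ : IsRootSystem Φ) {p : E m} (hp : Regular Φ p)
    (L : List (Equiv.Perm (E m))) : (∀ s ∈ L, s ∈ Sset Φ p) → ∀ β ∈ Φ, ∀ l : ℤ,
    phi β l p * phi β l (L.prod p) < 0 →
    ∃ L' : List (Equiv.Perm (E m)), (∀ s ∈ L', s ∈ Sset Φ p) ∧ L'.length < L.length ∧
      affRefl β l * L.prod = L'.prod := by
  induction L using List.reverseRecOn with
  | nil =>
    intro _ β _ l h
    simp only [List.prod_nil, Equiv.Perm.coe_one, id] at h
    nlinarith [mul_self_nonneg (phi β l p)]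
  | append_singleton L s ih =>
    intro hL β hβ l h
    have hL0 : ∀ s ∈ L, s ∈ Sset Φ p := fun t ht => hL t (by simp [ht])
    have hs : s ∈ Sset Φ p := hL s (by simp)
    have hv := list_mem hL0
    by_cases h1 : phi β l p * phi β l (L.prod p) < 0
    · obtain ⟨L', h2, h3, h4⟩ := ih hL0 β hβ l h1
      refine ⟨L' ++ [s], ?_, by simpa using h3, ?_⟩
      · intro t ht
        rcases List.mem_append.1 ht with h | h
        · exact h2 t h
        · rw [List.mem_singleton.1 h]; exact hs
      · simp [← h4, mul_assoc]
    · have h2 : phi β l (L.prod p) ≠ 0 := regular_map hΦ hv hp β hβ l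
      have h3 : phi β l p ≠ 0 := hp β hβ l
      have h4 : phi β l (L.prod p) * phi β l ((L ++ [s]).prod p) < 0 := by
        rcases lt_or_gt_of_ne h2 with h2 | h2 <;> rcases lt_or_gt_of_ne h3 with h3 | h3
        · nlinarith [pos_of_mul_neg_right h h3.le]
        · nlinarith
        · nlinarith
        · nlinarith [neg_of_mul_neg_right h h3.le]
      obtain ⟨β', hβ', l', h5, h6, -⟩ := conj_exists hΦ (inv_mem hv) hβ l
      obtain ⟨α, hα, k, rfl, hs'⟩ := hs
      rw [← h5, ← h5] at h4
      simp only [List.prod_append, List.prod_singleton, Equiv.Perm.coe_mul, Function.comp,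
        perm_inv_app] at h4
      have h7 := hs' β' hβ' l' h4
      refine ⟨L, hL0, by simp, ?_⟩
      rw [List.prod_append, List.prod_singleton, ← h7, h6]
      have := affRefl_mul_self β l
      calc _ = affRefl β l * affRefl β l * L.prod := by group
        _ = _ := by rw [this, one_mul]

lemma exists_word {Φ : Set (E m)} {p : E m} {w : Equiv.Perm (E m)}
    (hw : w ∈ Subgroup.closure (Sset Φ p)) :
    ∃ L : List (Equiv.Perm (E m)), (∀ s ∈ L, s ∈ Sset Φ p) ∧ L.prod = w := by
  have step : ∀ s ∈ Sset Φ p, ∀ w : Equiv.Perm (E m),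
      (∃ L : List (Equiv.Perm (E m)), (∀ s ∈ L, s ∈ Sset Φ p) ∧ L.prod = w) →
      ∃ L : List (Equiv.Perm (E m)), (∀ s ∈ L, s ∈ Sset Φ p) ∧ L.prod = s * w := by
    rintro s hs w ⟨L, h1, h2⟩
    refine ⟨s :: L, ?_, by simp [h2]⟩
    intro t ht
    rcases List.mem_cons.1 ht with h | h
    · rw [h]; exact hs
    · exact h1 t h
  induction hw using Subgroup.closure_induction_left with
  | one => exact ⟨[], by simp, by simp⟩
  | mul_left x hx y hy ih => exact step x hx y ih
  | inv_mul_cancel x hx y hy ih =>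
    have : x⁻¹ = x := by
      obtain ⟨α, hα, k, rfl, -⟩ := hx
      exact affRefl_inv α k
    rw [this]
    exact step x hx y ih

lemma fix_of_closure {Φ : Set (E m)} (hΦ : IsRootSystem Φ) {p : E m} (hp : Regular Φ p)
    {w : Equiv.Perm (E m)} (hw : w ∈ Subgroup.closure (Sset Φ p)) (hwp : w p = p) : w = 1 := by
  classical
  have hex : ∃ n : ℕ, ∃ L : List (Equiv.Perm (E m)), L.length = n ∧
      (∀ s ∈ L, s ∈ Sset Φ p) ∧ L.prod = w := by
    obtain ⟨L, h⟩ := exists_word hw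
    exact ⟨_, L, rfl, h⟩
  obtain ⟨L, hlen, hL, hLw⟩ := Nat.find_spec hex
  have hmin : ∀ L' : List (Equiv.Perm (E m)), (∀ s ∈ L', s ∈ Sset Φ p) → L'.prod = w →
      L.length ≤ L'.length := by
    intro L' h1 h2
    rw [hlen]
    exact Nat.find_min' hex ⟨L', rfl, h1, h2⟩
  clear hlen hex
  induction L using List.reverseRecOn with
  | nil => simpa using hLw.symm
  | append_singleton L s ih =>
    exfalso
    have hL0 : ∀ s ∈ L, s ∈ Sset Φ p := fun t ht => hL t (by simp [ht])
    have hs : s ∈ Sset Φ p := hL s (by simp)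
    obtain ⟨α, hα, k, rfl, -⟩ := hs
    obtain ⟨β, hβ, l, h5, h6, -⟩ := conj_exists hΦ (list_mem hL0) hα k
    have hvs : L.prod (affRefl α k p) = p := by
      rw [← hLw] at hwp
      simpa using hwp
    have h7 : phi β l p * phi β l (L.prod p) < 0 := by
      have h8 := h5 (affRefl α k p)
      rw [hvs, phi_self (hΦ.ne_zero α hα)] at h8
      rw [h8, h5]
      have := hp α hα k
      have := mul_self_pos.2 this
      linarith
    obtain ⟨L', h1, h2, h3⟩ := exchange hΦ hp L hL0 β hβ l h7
    have := hmin L' h1 (by rw [← h3, h6, ← hLw]; simp)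
    simp at this
    omega

/-- Vector from the foot of the perpendicular to the point. -/
def foot (p α : E m) (k : ℤ) : E m := (phi α k p / ⟪α, α⟫) • α

/-- Squared distance to the wall. -/
def dsq (p α : E m) (k : ℤ) : ℝ := phi α k p ^ 2 / ⟪α, α⟫

lemma inner_foot {p α β : E m} (hα : α ≠ 0) (k l : ℤ) :
    ⟪foot p α k, foot p β l⟫ = phi α k p * phi β l p * ⟪α, β⟫ / (⟪α, α⟫ * ⟪β, β⟫) := by
  unfold foot
  rw [real_inner_smul_left, real_inner_smul_right]
  ring

lemma inner_foot_self {p α : E m} (hα : α ≠ 0) (k : ℤ) :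
    ⟪foot p α k, foot p α k⟫ = dsq p α k := by
  have hαα : ⟪α, α⟫ ≠ (0:ℝ) := (inner_self_ne_zero (𝕜 := ℝ)).mpr hα
  rw [inner_foot hα]
  unfold dsq
  field_simp

lemma affRefl_foot {p α : E m} (hα : α ≠ 0) (k : ℤ) (h : phi α k p ≠ 0) (y : E m) :
    affRefl α k y = y - (2 * ⟪foot p α k, y - p + foot p α k⟫ / ⟪foot p α k, foot p α k⟫) •
      foot p α k := by
  have hαα : ⟪α, α⟫ ≠ (0:ℝ) := (inner_self_ne_zero (𝕜 := ℝ)).mpr hα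
  rw [affRefl_apply, inner_add_right, inner_foot_self hα]
  unfold foot dsq coroot
  rw [smul_smul, smul_smul, real_inner_smul_left, inner_sub_right]
  congr 2
  have e : ⟪α, y⟫ - ⟪α, p⟫ = phi α k y - phi α k p := by unfold phi; ring
  rw [e]
  field_simp
  ring

lemma finite_dsq {Φ : Set (E m)} (hΦ : IsRootSystem Φ) (p : E m) (M : ℝ) :
    {q : E m × ℤ | q.1 ∈ Φ ∧ dsq p q.1 q.2 < M}.Finite := by
  have : (⋃ α ∈ Φ, (fun k : ℤ => (α, k)) ''
      (Set.Icc ⌊⟪α, p⟫ - (M * ⟪α, α⟫ + 1)⌋ ⌈⟪α, p⟫ + (M * ⟪α, α⟫ + 1)⌉)).Finite :=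
    hΦ.finite.biUnion fun α _ => (Set.finite_Icc _ _).image _
  refine this.subset ?_
  rintro ⟨α, k⟩ ⟨hα, hd⟩
  simp only at hα hd
  simp only [Set.mem_iUnion, Set.mem_image]
  refine ⟨α, hα, k, ?_, rfl⟩
  have hαα : 0 < ⟪α, α⟫ := real_inner_self_pos.2 (hΦ.ne_zero α hα)
  unfold dsq at hd
  rw [div_lt_iff₀ hαα] at hd
  have h1 : ⟪α, p⟫ - k = phi α k p := rfl
  have h2 : (k : ℝ) = ⟪α, p⟫ - phi α k p := by rw [← h1]; ring
  constructor
  · have : (⌊⟪α, p⟫ - (M * ⟪α, α⟫ + 1)⌋ : ℝ) ≤ k := by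
      refine (Int.floor_le _).trans ?_
      rw [h2]
      nlinarith [sq_nonneg (phi α k p - 1), sq_nonneg (phi α k p)]
    exact_mod_cast this
  · have : (k : ℝ) ≤ ⌈⟪α, p⟫ + (M * ⟪α, α⟫ + 1)⌉ := by
      refine le_trans ?_ (Int.le_ceil _)
      rw [h2]
      nlinarith [sq_nonneg (phi α k p + 1), sq_nonneg (phi α k p)]
    exact_mod_cast this

lemma exists_good_wall {Φ : Set (E m)} (hΦ : IsRootSystem Φ) {p : E m} (hp : Regular Φ p)
    {α : E m} (hα : α ∈ Φ) (k : ℤ) {β : E m} (hβ : β ∈ Φ) (l : ℤ)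
    (h : phi β l p * phi β l (affRefl α k p) < 0) (hne : affRefl β l ≠ affRefl α k) :
    ∃ β ∈ Φ, ∃ l : ℤ, affRefl β l ≠ affRefl α k ∧
      phi β l p * (phi β l p + phi β l (affRefl α k p)) ≤ 0 := by
  by_cases h1 : phi β l p * (phi β l p + phi β l (affRefl α k p)) ≤ 0
  · exact ⟨β, hβ, l, hne, h1⟩
  · obtain ⟨β', hβ', l', h2, h3, -⟩ := conj_exists hΦ (affRefl_mem hα k) hβ l
    have e1 : phi β' l' p = phi β l (affRefl α k p) := by
      rw [← h2]
      congr 1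
      exact (affReflFun_involutive α k p).symm
    refine ⟨β', hβ', l', ?_, ?_⟩
    · intro h4
      apply hne
      rw [h4, eq_mul_inv_iff_mul_eq] at h3
      exact (mul_left_cancel h3).symm
    · rw [e1, h2]
      push Not at h1
      set x := phi β l p
      set y := phi β l (affRefl α k p)
      rcases lt_trichotomy x 0 with hx | hx | hx
      · have : 0 < y := pos_of_mul_neg_right h hx.le
        have : x + y < 0 := neg_of_mul_pos_right h1 hx.le
        nlinarith
      · rw [hx] at h; simp at h
      · have : y < 0 := neg_of_mul_neg_right h hx.le
        have : 0 < x + y := pos_of_mul_pos_right h1 hx.le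
        nlinarith

lemma refl_mem_closure {Φ : Set (E m)} (hΦ : IsRootSystem Φ) {p : E m} (hp : Regular Φ p)
    (n : ℕ) : ∀ α ∈ Φ, ∀ k : ℤ,
    {q : E m × ℤ | q.1 ∈ Φ ∧ dsq p q.1 q.2 < dsq p α k}.ncard = n →
    affRefl α k ∈ Subgroup.closure (Sset Φ p) := by
  induction n using Nat.strong_induction_on with
  | _ n ih =>
  intro α hα k hn
  have key : ∀ β ∈ Φ, ∀ l : ℤ, dsq p β l < dsq p α k →
      affRefl β l ∈ Subgroup.closure (Sset Φ p) := by
    intro β hβ l hd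
    refine ih _ ?_ β hβ l rfl
    rw [← hn]
    refine Set.ncard_lt_ncard ?_ (finite_dsq hΦ p _)
    refine ⟨fun q hq => ⟨hq.1, hq.2.trans hd⟩, fun hsub => ?_⟩
    have := hsub (show (β, l) ∈ _ from ⟨hβ, hd⟩)
    exact lt_irrefl _ this.2
  by_cases hS : affRefl α k ∈ Sset Φ p
  · exact Subgroup.subset_closure hS
  have h0 : ∃ β ∈ Φ, ∃ l : ℤ, phi β l p * phi β l (affRefl α k p) < 0 ∧
      affRefl β l ≠ affRefl α k := by
    by_contra hcon
    push Not at hcon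
    exact hS ⟨α, hα, k, rfl, hcon⟩
  obtain ⟨β₀, hβ₀, l₀, h1, h2⟩ := h0
  obtain ⟨β, hβ, l, hne, hle⟩ := exists_good_wall hΦ hp hα k hβ₀ l₀ h1 h2
  have hα0 := hΦ.ne_zero α hα
  have hβ0 := hΦ.ne_zero β hβ
  have hαα : 0 < ⟪α, α⟫ := real_inner_self_pos.2 hα0
  have hββ : 0 < ⟪β, β⟫ := real_inner_self_pos.2 hβ0
  have ha := hp α hα k
  have hb := hp β hβ l
  set f := foot p α k with hf
  set g := foot p β l with hg
  have hff : ⟪f, f⟫ = dsq p α k := inner_foot_self hα0 k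
  have hgg : ⟪g, g⟫ = dsq p β l := inner_foot_self hβ0 l
  have hfg : ⟪f, g⟫ = phi α k p * phi β l p * ⟪α, β⟫ / (⟪α, α⟫ * ⟪β, β⟫) := inner_foot hα0 k l
  have hpos : 0 < ⟪g, g⟫ := by
    rw [hgg]; unfold dsq
    positivity
  have hfpos : 0 < ⟪f, f⟫ := by
    rw [hff]; unfold dsq
    positivity
  have e1 : phi β l (affRefl α k p) = phi β l p - 2 * phi α k p * ⟪α, β⟫ / ⟪α, α⟫ := by
    rw [affRefl_apply]
    unfold coroot
    simp only [phi]
    rw [inner_sub_right, inner_smul_right, inner_smul_right, real_inner_comm α β]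
    ring
  have e2 : phi α k (affRefl β l p) = phi α k p - 2 * phi β l p * ⟪α, β⟫ / ⟪β, β⟫ := by
    rw [affRefl_apply]
    unfold coroot
    simp only [phi]
    rw [inner_sub_right, inner_smul_right, inner_smul_right]
    ring
  have h3 : ⟪g, g⟫ ≤ ⟪f, g⟫ := by
    rw [hgg, hfg]
    unfold dsq
    rw [e1] at hle
    rw [div_le_div_iff₀ hββ (by positivity)]
    have h5 : phi β l p * phi β l p * ⟪α, α⟫ ≤ phi β l p * (phi α k p * ⟪α, β⟫) := by
      have : phi β l p * (phi β l p + (phi β l p - 2 * phi α k p * ⟪α, β⟫ / ⟪α, α⟫)) * ⟪α, α⟫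
        ≤ 0 := mul_nonpos_of_nonpos_of_nonneg hle hαα.le
      field_simp at this
      nlinarith
    nlinarith
  have hne' : f ≠ g := by
    intro hfg'
    apply hne
    ext1 y
    rw [affRefl_foot hβ0 l hb, affRefl_foot hα0 k ha, ← hf, ← hg, hfg']
  have h4 : 0 < ⟪f - g, f - g⟫ := real_inner_self_pos.2 (sub_ne_zero.2 hne')
  have h5 : ⟪f - g, f - g⟫ = ⟪f, f⟫ - 2 * ⟪f, g⟫ + ⟪g, g⟫ := by
    rw [real_inner_sub_sub_self]
  have hlt : ⟪g, g⟫ < ⟪f, f⟫ := by linarith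
  have hlt2 : ⟪f, g⟫ < ⟪f, f⟫ := by
    linarith
  have hsβ := key β hβ l (by rw [← hgg, ← hff]; exact hlt)
  obtain ⟨γ, hγ, j, h6, h7, h8⟩ := conj_exists hΦ (affRefl_mem hβ l) hα k
  have hsγ : affRefl γ j ∈ Subgroup.closure (Sset Φ p) := by
    refine key γ hγ j ?_
    have e3 : phi γ j p = phi α k (affRefl β l p) := by
      rw [← h6]
      congr 1
      exact (affReflFun_involutive β l p).symm
    unfold dsq
    rw [e3, h8, e2]
    apply div_lt_div_of_pos_right _ hαα
    have e4 : ⟪f, g⟫ * ⟪α, α⟫ = phi α k p * (phi β l p * ⟪α, β⟫ / ⟪β, β⟫) := by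
      rw [hfg]; field_simp
    have e5 : ⟪f, f⟫ * ⟪α, α⟫ = phi α k p ^ 2 := by
      rw [hff]; unfold dsq; field_simp
    have e6 : 2 * phi β l p * ⟪α, β⟫ / ⟪β, β⟫ = 2 * (phi β l p * ⟪α, β⟫ / ⟪β, β⟫) := by ring
    rw [e6]
    set x := phi β l p * ⟪α, β⟫ / ⟪β, β⟫
    set a := phi α k p
    have g1 : 0 < a * x := by rw [← e4]; exact mul_pos (by linarith) hαα
    have g2 : a * x < a ^ 2 := by
      rw [← e4, ← e5]; exact mul_lt_mul_of_pos_right hlt2 hαα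
    have g3 : (a * x) * (a * x) < (a * x) * a ^ 2 := mul_lt_mul_of_pos_left g2 g1
    have g4 : a ^ 2 * (x ^ 2) < a ^ 2 * (a * x) := by linarith
    have g5 : x ^ 2 < a * x := lt_of_mul_lt_mul_left g4 (sq_nonneg a)
    linarith
  have : affRefl α k = affRefl β l * affRefl γ j * affRefl β l := by
    rw [h7, affRefl_inv]
    have e := affRefl_mul_self β l
    calc affRefl α k = 1 * affRefl α k * 1 := by simp
      _ = (affRefl β l * affRefl β l) * affRefl α k * (affRefl β l * affRefl β l) := by rw [e]
      _ = _ := by simp only [mul_assoc]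
  rw [this]
  exact mul_mem (mul_mem hsβ hsγ) hsβ

theorem eq_one_of_fix_regular {Φ : Set (E m)} (hΦ : IsRootSystem Φ) {p : E m}
    (hp : Regular Φ p) {w : Equiv.Perm (E m)} (hw : w ∈ Waff Φ) (hwp : w p = p) : w = 1 := by
  refine fix_of_closure hΦ hp ?_ hwp
  refine (Subgroup.closure_le _).2 ?_ hw
  rintro s ⟨α, hα, k, rfl⟩
  exact refl_mem_closure hΦ hp _ α hα k rfl

lemma exists_order {Φ : Set (E m)} (hΦ : IsRootSystem Φ) (u : E m ≃ₗᵢ[ℝ] E m)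
    (hu : ∀ α, u α ∈ Φ ↔ α ∈ Φ) : ∃ n : ℕ, 0 < n ∧ ∀ x, (u^[n]) x = x := by
  have : Finite Φ := hΦ.finite
  let σ : Equiv.Perm Φ := Equiv.Perm.subtypePerm (p := fun x => x ∈ Φ) u.toEquiv (fun x => hu x)
  obtain ⟨n, hn, h1⟩ := (isOfFinOrder_of_finite σ).exists_pow_eq_one
  refine ⟨n, hn, ?_⟩
  have hσ : ∀ (j : ℕ) (a : Φ), (((σ ^ j) a : Φ) : E m) = (u^[j]) a := by
    intro j
    induction j with
    | zero => intro a; rfl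
    | succ j ih =>
      intro a
      rw [pow_succ', Function.iterate_succ_apply', ← ih]
      rfl
  have hlin : ∀ j : ℕ, ∀ x, ((u.toLinearEquiv.toLinearMap ^ j : E m →ₗ[ℝ] E m)) x = (u^[j]) x := by
    intro j x
    rw [Module.End.pow_apply]
    rfl
  have heq : (u.toLinearEquiv.toLinearMap ^ n : E m →ₗ[ℝ] E m) = LinearMap.id := by
    refine LinearMap.ext_on hΦ.span_eq_top ?_
    intro a ha
    rw [hlin, ← hσ n ⟨a, ha⟩, h1]
    rfl
  intro x
  rw [← hlin, heq]
  rfl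

lemma iterate_affine {f : E m → E m} {u : E m ≃ₗᵢ[ℝ] E m} (hf : ∀ x, f x = u x + f 0)
    (n : ℕ) : ∀ x, (f^[n]) x = (u^[n]) x + (f^[n]) 0 := by
  induction n with
  | zero => intro x; simp
  | succ n ih =>
    intro x
    rw [Function.iterate_succ_apply', Function.iterate_succ_apply', Function.iterate_succ_apply',
      hf, ih, map_add, hf ((f^[n]) 0)]
    abel

lemma exists_fixed {f : E m → E m} {u : E m ≃ₗᵢ[ℝ] E m} (hf : ∀ x, f x = u x + f 0)
    {T : Set (E m)} (hT : Convex ℝ T) (hfT : ∀ y ∈ T, f y ∈ T) {n : ℕ} (hn : 0 < n)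
    {y : E m} (hy : y ∈ T) (hfy : (f^[n]) y = y) : ∃ x ∈ T, f x = x := by
  have hmem : ∀ j, (f^[j]) y ∈ T := by
    intro j
    induction j with
    | zero => exact hy
    | succ j ih => rw [Function.iterate_succ_apply']; exact hfT _ ih
  have hn' : (n : ℝ) ≠ 0 := by positivity
  refine ⟨∑ j ∈ Finset.range n, (1 / (n : ℝ)) • (f^[j]) y, ?_, ?_⟩
  · refine hT.sum_mem ?_ ?_ ?_
    · intro j _; positivity
    · simp [hn']
    · intro j _; exact hmem j
  · rw [← Finset.smul_sum, hf, map_smul, map_sum]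
    have h1 : f 0 = (1 / (n : ℝ)) • ∑ j ∈ Finset.range n, f 0 := by
      rw [Finset.sum_const, Finset.card_range, ← Nat.cast_smul_eq_nsmul ℝ, smul_smul]
      field_simp
      simp
    rw [h1, ← smul_add, ← Finset.sum_add_distrib]
    congr 1
    have h2 : ∀ j ∈ Finset.range n, u ((f^[j]) y) + f 0 = (f^[j + 1]) y := by
      intro j _
      rw [← hf, Function.iterate_succ_apply']
    rw [Finset.sum_congr rfl h2]
    have h3 := Finset.sum_range_succ (fun j => (f^[j]) y) n
    have h4 := Finset.sum_range_succ' (fun j => (f^[j]) y) n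
    rw [h3, hfy] at h4
    simpa using h4.symm

/-- Explicit description of the tube through `x`. -/
def tubeQ (Φ : Set (E m)) (β x : E m) : Set (E m) :=
  {y | ∀ α ∈ Φ, ⟪α, β⟫ = (0:ℝ) → (⌊⟪α, x⟫⌋ : ℝ) < ⟪α, y⟫ ∧ ⟪α, y⟫ < ⌊⟪α, x⟫⌋ + 1}

lemma notMem_tubeWalls {Φ : Set (E m)} {β y : E m} : y ∈ (tubeWalls Φ β)ᶜ ↔
    ∀ α ∈ Φ, ⟪α, β⟫ = (0:ℝ) → ∀ k : ℤ, ⟪α, y⟫ ≠ (k : ℝ) := by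
  simp only [tubeWalls, wall, Set.mem_compl_iff, Set.mem_iUnion, Set.mem_setOf_eq, not_exists]
  constructor
  · intro h α h1 h2 k hk
    exact h α ⟨h1, h2⟩ k hk
  · intro h α h1 k hk
    exact h α h1.1 h1.2 k hk

lemma tubeQ_convex (Φ : Set (E m)) (β x : E m) : Convex ℝ (tubeQ Φ β x) := by
  intro y hy z hz a b ha hb hab α h1 h2
  obtain ⟨y1, y2⟩ := hy α h1 h2
  obtain ⟨z1, z2⟩ := hz α h1 h2
  rw [inner_add_right, inner_smul_right, inner_smul_right]
  have : b = 1 - a := by linarith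
  subst this
  rcases ha.eq_or_lt with h | h
  · subst h; simp; exact ⟨z1, z2⟩
  · constructor <;> nlinarith

lemma self_mem_tubeQ {Φ : Set (E m)} {β x : E m} (hx : x ∈ (tubeWalls Φ β)ᶜ) :
    x ∈ tubeQ Φ β x := by
  rw [notMem_tubeWalls] at hx
  intro α h1 h2
  exact ⟨lt_of_le_of_ne (Int.floor_le _) (hx α h1 h2 _).symm, Int.lt_floor_add_one _⟩

lemma tubeQ_sub {Φ : Set (E m)} {β x : E m} : tubeQ Φ β x ⊆ (tubeWalls Φ β)ᶜ := by
  intro y hy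
  rw [notMem_tubeWalls]
  intro α h1 h2 k hk
  obtain ⟨y1, y2⟩ := hy α h1 h2
  rw [hk] at y1 y2
  have y1' : ⌊⟪α, x⟫⌋ < k := by exact_mod_cast y1
  have y2' : k < ⌊⟪α, x⟫⌋ + 1 := by exact_mod_cast y2
  omega

lemma tube_eq {Φ : Set (E m)} {β x : E m} (hx : x ∈ (tubeWalls Φ β)ᶜ) :
    connectedComponentIn (tubeWalls Φ β)ᶜ x = tubeQ Φ β x := by
  apply Set.Subset.antisymm
  · intro y hy α h1 h2
    have hsub := connectedComponentIn_subset (tubeWalls Φ β)ᶜ x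
    have hxm : x ∈ connectedComponentIn (tubeWalls Φ β)ᶜ x := mem_connectedComponentIn hx
    have hpre : IsPreconnected ((fun z => ⟪α, z⟫) '' connectedComponentIn (tubeWalls Φ β)ᶜ x) :=
      isPreconnected_connectedComponentIn.image _ (by fun_prop)
    have hoc := hpre.ordConnected
    have hno : ∀ k : ℤ, (k : ℝ) ∉ (fun z => ⟪α, z⟫) '' connectedComponentIn (tubeWalls Φ β)ᶜ x := by
      rintro k ⟨z, hz, hzk⟩
      exact notMem_tubeWalls.1 (hsub hz) α h1 h2 k hzk
    have hxi := Set.mem_image_of_mem (fun z => ⟪α, z⟫) hxm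
    have hyi := Set.mem_image_of_mem (fun z => ⟪α, z⟫) hy
    obtain ⟨x1, x2⟩ := self_mem_tubeQ hx α h1 h2
    constructor
    · by_contra hcon
      push Not at hcon
      exact hno _ (hoc.out hyi hxi ⟨hcon, x1.le⟩)
    · by_contra hcon
      push Not at hcon
      refine hno (⌊⟪α, x⟫⌋ + 1) (hoc.out hxi hyi ⟨?_, ?_⟩)
      · push_cast; exact x2.le
      · push_cast; exact hcon
  · exact (tubeQ_convex Φ β x).isPreconnected.subset_connectedComponentIn
      (self_mem_tubeQ hx) tubeQ_sub

lemma tubeQ_add {Φ : Set (E m)} {β x y : E m} (hy : y ∈ tubeQ Φ β x) (t : ℝ) :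
    y + t • β ∈ tubeQ Φ β x := by
  intro α h1 h2
  rw [inner_add_right, inner_smul_right, h2, mul_zero, add_zero]
  exact hy α h1 h2

lemma eq_smul_of_orth {B ω : Fin m → E m} (hB : LinearIndependent ℝ B)
    (hω : IsFundamentalCoweights B ω) (i : Fin m) {μ : E m}
    (h : ∀ j, j ≠ i → ⟪B j, μ⟫ = (0 : ℝ)) : μ = ⟪B i, μ⟫ • ω i := by
  have hspan : Submodule.span ℝ (Set.range B) = ⊤ :=
    hB.span_eq_top_of_card_eq_finrank' (by simp)
  rw [← sub_eq_zero]
  set ν := μ - ⟪B i, μ⟫ • ω i with hν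
  have h1 : ∀ j, ⟪B j, ν⟫ = (0 : ℝ) := by
    intro j
    rw [hν, inner_sub_right, inner_smul_right, hω j i]
    by_cases hj : j = i
    · subst hj; simp
    · rw [h j hj]; simp [hj]
  have h2 : ∀ v ∈ Submodule.span ℝ (Set.range B), ⟪v, ν⟫ = (0 : ℝ) := by
    intro v hv
    induction hv using Submodule.span_induction with
    | mem x hx => obtain ⟨j, rfl⟩ := hx; exact h1 j
    | zero => simp
    | add x y _ _ hx hy => rw [inner_add_left, hx, hy, add_zero]
    | smul a x _ hx => rw [real_inner_smul_left, hx, mul_zero]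
  exact inner_self_eq_zero.1 (h2 ν (by rw [hspan]; trivial))

lemma trans_parallel {Φ : Set (E m)} {B ω : Fin m → E m} (hB : IsSimpleSystem Φ B)
    (hω : IsFundamentalCoweights B ω) (i : Fin m) {x y μ : E m}
    (h : ∀ n : ℕ, y + (n : ℝ) • μ ∈ tubeQ Φ (ω i) x) : μ = ⟪B i, μ⟫ • ω i := by
  refine eq_smul_of_orth hB.indep hω i fun j hj => ?_
  by_contra hne
  have h2 : ⟪B j, ω i⟫ = (0 : ℝ) := by rw [hω j i]; simp [hj]
  obtain ⟨n, hn⟩ := exists_nat_gt (1 / |⟪B j, μ⟫|)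
  have h3 := h n (B j) (hB.mem j) h2
  have h4 := h 0 (B j) (hB.mem j) h2
  rw [inner_add_right, inner_smul_right] at h3 h4
  have h5 : |(n : ℝ) * ⟪B j, μ⟫| < 1 := by
    simp only [Nat.cast_zero, zero_mul, add_zero] at h4
    rw [abs_lt]; constructor <;> linarith [h3.1, h3.2, h4.1, h4.2]
  rw [div_lt_iff₀ (abs_pos.2 hne)] at hn
  rw [abs_mul, Nat.abs_cast] at h5
  linarith

lemma exists_regular {Φ : Set (E m)} (hΦ : IsRootSystem Φ) {β x₀ : E m}
    (h : x₀ ∈ (tubeWalls Φ β)ᶜ) : ∃ t : ℝ, Regular Φ (x₀ + t • β) := by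
  have hc : (⋃ α ∈ Φ, ⋃ k : ℤ, {(((k : ℝ) - ⟪α, x₀⟫) / ⟪α, β⟫ : ℝ)}).Countable :=
    hΦ.finite.countable.biUnion fun α _ => Set.countable_iUnion fun k => Set.countable_singleton _
  obtain ⟨t, ht⟩ := (hc.dense_compl ℝ).nonempty
  refine ⟨t, fun α hα k h0 => ?_⟩
  unfold phi at h0
  rw [inner_add_right, inner_smul_right] at h0
  by_cases hz : ⟪α, β⟫ = (0 : ℝ)
  · rw [hz] at h0
    exact notMem_tubeWalls.1 h α hα hz k (by linarith)
  · apply ht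
    simp only [Set.mem_iUnion, Set.mem_singleton_iff]
    refine ⟨α, hα, k, ?_⟩
    rw [eq_div_iff hz]
    linarith

lemma iterate_zero_trans {Φ : Set (E m)} {B ω : Fin m → E m} (hB : IsSimpleSystem Φ B)
    (hω : IsFundamentalCoweights B ω) (i : Fin m) {x y μ : E m} {f : E m → E m}
    (hf : ∀ y ∈ tubeQ Φ (ω i) x, f y ∈ tubeQ Φ (ω i) x) (hy : y ∈ tubeQ Φ (ω i) x)
    {n : ℕ} (hn : ∀ z, (f^[n]) z = z + μ) : μ = ⟪B i, μ⟫ • ω i := by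
  refine trans_parallel hB hω i (x := x) (y := y) ?_
  have hfn : ∀ j, ∀ z ∈ tubeQ Φ (ω i) x, (f^[j]) z ∈ tubeQ Φ (ω i) x := by
    intro j
    induction j with
    | zero => intro z hz; exact hz
    | succ j ih => intro z hz; rw [Function.iterate_succ_apply]; exact ih _ (hf z hz)
  intro k
  induction k with
  | zero => simpa using hy
  | succ k ih =>
    have := hfn n _ ih
    rw [hn] at this
    convert this using 1
    push_cast
    module

lemma not_hyp_of_fixed {f : E m → E m} {x : E m} (h : f x = x) : ¬ IsHyperbolic f := by
  rintro ⟨-, h2⟩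
  have : minDisp f ≤ dist x (f x) := by
    refine ciInf_le ⟨0, ?_⟩ x
    rintro _ ⟨y, rfl⟩
    exact dist_nonneg
  rw [h, dist_self] at this
  linarith

lemma stab_dir {Φ : Set (E m)} {B ω : Fin m → E m}
    (hB : IsSimpleSystem Φ B) (hω : IsFundamentalCoweights B ω) (i : Fin m) {x : E m}
    {w : Equiv.Perm (E m)} {u : E m ≃ₗᵢ[ℝ] E m} (ha : ∀ x, w x = u x + w 0)
    (hx : x ∈ tubeQ Φ (ω i) x)
    (hT : ∀ y ∈ tubeQ Φ (ω i) x, w y ∈ tubeQ Φ (ω i) x) :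
    u (ω i) = ω i ∨ u (ω i) = - ω i := by
  have h1 : u (ω i) = ⟪B i, u (ω i)⟫ • ω i := by
    refine trans_parallel hB hω i (x := x) (y := w x) fun n => ?_
    have := hT _ (tubeQ_add hx (n : ℝ))
    rw [ha, map_add, map_smul] at this
    rw [ha x]
    convert this using 1
    abel
  have hne : ω i ≠ 0 := by
    intro h0
    have := hω i i
    rw [h0] at this
    simp at this
  set c : ℝ := ⟪B i, u (ω i)⟫
  have h2 : ‖u (ω i)‖ = ‖ω i‖ := u.norm_map _
  rw [h1, norm_smul, Real.norm_eq_abs] at h2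
  have h3 : |c| = 1 := mul_right_cancel₀ (norm_ne_zero_iff.2 hne) (by rw [h2, one_mul])
  rw [h1]
  rcases eq_or_eq_neg_of_abs_eq h3 with h | h
  · left; rw [h, one_smul]
  · right; rw [h, neg_smul, one_smul]

/-- The stabilizers preserving the direction. -/
def dirStab (Φ : Set (E m)) (β : E m) (T : Set (E m)) : Subgroup (Equiv.Perm (E m)) where
  carrier := {w | w ∈ Waff Φ ∧ (w : E m → E m) '' T = T ∧ ∀ y, w (y + β) = w y + β}
  one_mem' := ⟨one_mem _, by simp, by simp⟩
  mul_mem' := by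
    rintro a b ⟨a1, a2, a3⟩ ⟨b1, b2, b3⟩
    refine ⟨mul_mem a1 b1, ?_, ?_⟩
    · rw [Equiv.Perm.coe_mul, Set.image_comp, b2, a2]
    · intro y
      simp only [Equiv.Perm.coe_mul, Function.comp]
      rw [b3, a3]
  inv_mem' := by
    rintro a ⟨a1, a2, a3⟩
    refine ⟨inv_mem a1, ?_, ?_⟩
    · conv_lhs => rw [← a2]
      rw [← Set.image_comp, ← Equiv.Perm.coe_mul]
      simp
    · intro y
      apply a.injective
      rw [a3]
      have h : ∀ z, a (a⁻¹ z) = z := fun z => a.apply_symm_apply z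
      rw [h, h]

/-- Translation coefficient. -/
def tcoef (β : E m) (w : Equiv.Perm (E m)) : ℝ := ⟪w 0, β⟫ / ⟪β, β⟫

lemma dirStab_lin {Φ : Set (E m)} (hΦ : IsRootSystem Φ) {β : E m} {T : Set (E m)}
    {w : Equiv.Perm (E m)} (hw : w ∈ dirStab Φ β T) :
    ∃ u, GoodWith Φ w u ∧ u β = β := by
  obtain ⟨u, hu⟩ := good_of_mem hΦ hw.1
  refine ⟨u, hu, ?_⟩
  have := hw.2.2 0
  rw [zero_add, hu.1, add_comm] at this
  exact add_left_cancel this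

lemma inner_dirStab {Φ : Set (E m)} (hΦ : IsRootSystem Φ) {β : E m} (hβ : β ≠ 0) {T : Set (E m)}
    {w : Equiv.Perm (E m)} (hw : w ∈ dirStab Φ β T) (y : E m) :
    ⟪w y, β⟫ = ⟪y, β⟫ + tcoef β w * ⟪β, β⟫ := by
  have hββ : ⟪β, β⟫ ≠ (0:ℝ) := (inner_self_ne_zero (𝕜 := ℝ)).mpr hβ
  obtain ⟨u, hu, h⟩ := dirStab_lin hΦ hw
  rw [hu.1, inner_add_left, tcoef, div_mul_cancel₀ _ hββ]
  congr 1
  conv_lhs => rw [← h]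
  exact u.inner_map_map _ _

lemma exists_axis {Φ : Set (E m)} (hΦ : IsRootSystem Φ) {B ω : Fin m → E m}
    (hB : IsSimpleSystem Φ B) (hω : IsFundamentalCoweights B ω) (i : Fin m) {x : E m}
    (hx : x ∈ tubeQ Φ (ω i) x) (hne : ω i ≠ 0)
    {w : Equiv.Perm (E m)} (hw : w ∈ dirStab Φ (ω i) (tubeQ Φ (ω i) x)) :
    ∃ x₀ ∈ tubeQ Φ (ω i) x, w x₀ = x₀ + tcoef (ω i) w • ω i := by
  have hββ : ⟪ω i, ω i⟫ ≠ (0:ℝ) := (inner_self_ne_zero (𝕜 := ℝ)).mpr hne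
  obtain ⟨u, hu, h⟩ := dirStab_lin hΦ hw
  obtain ⟨n, hn, hun⟩ := exists_order hΦ u hu.2.1
  set c := tcoef (ω i) w with hc
  let f : E m → E m := fun y => w y - c • ω i
  have hf : ∀ y, f y = u y + f 0 := by
    intro y
    simp only [f]
    rw [hu.1 y]
    abel
  have hfT : ∀ y ∈ tubeQ Φ (ω i) x, f y ∈ tubeQ Φ (ω i) x := by
    intro y hy
    have h1 : w y ∈ tubeQ Φ (ω i) x := by
      have := Set.mem_image_of_mem w hy
      rwa [hw.2.1] at this
    have := tubeQ_add h1 (-c)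
    rwa [neg_smul, ← sub_eq_add_neg] at this
  have hit : ∀ z, (f^[n]) z = z + (f^[n]) 0 := by
    intro z
    rw [iterate_affine hf n z, hun]
  have hμ := iterate_zero_trans hB hω i hfT hx hit
  have hin : ∀ j z, ⟪(f^[j]) z, ω i⟫ = ⟪z, ω i⟫ := by
    intro j
    induction j with
    | zero => intro z; rfl
    | succ j ih =>
      intro z
      rw [Function.iterate_succ_apply, ih]
      simp only [f]
      rw [inner_sub_left, inner_dirStab hΦ hne hw, real_inner_smul_left, ← hc]
      ring
  have hμ0 : (f^[n]) 0 = 0 := by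
    have h1 := hin n 0
    rw [inner_zero_left, hμ, real_inner_smul_left] at h1
    rcases mul_eq_zero.1 h1 with h2 | h2
    · rw [hμ, h2, zero_smul]
    · exact absurd h2 hββ
  obtain ⟨x₀, h1, h2⟩ := exists_fixed hf (tubeQ_convex _ _ _) hfT hn hx
    (by rw [hit, hμ0, add_zero])
  exact ⟨x₀, h1, sub_eq_iff_eq_add.1 h2⟩

lemma mem_dirStab_of_hyp {Φ : Set (E m)} (hΦ : IsRootSystem Φ) {B ω : Fin m → E m}
    (hB : IsSimpleSystem Φ B) (hω : IsFundamentalCoweights B ω) (i : Fin m) {x : E m}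
    (hx : x ∈ tubeQ Φ (ω i) x)
    {w : Equiv.Perm (E m)} (hw : IsHypStab Φ (tubeQ Φ (ω i) x) w) :
    w ∈ dirStab Φ (ω i) (tubeQ Φ (ω i) x) := by
  obtain ⟨h1, h2, h3⟩ := hw
  refine ⟨h1, h3, ?_⟩
  obtain ⟨u, hu⟩ := good_of_mem hΦ h1
  have hT : ∀ y ∈ tubeQ Φ (ω i) x, w y ∈ tubeQ Φ (ω i) x := by
    intro y hy
    have := Set.mem_image_of_mem w hy
    rwa [h3] at this
  rcases stab_dir hB hω i hu.1 hx hT with h | h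
  · intro y
    rw [hu.1, map_add, h, hu.1 y]
    abel
  · exfalso
    obtain ⟨n, hn, hun⟩ := exists_order hΦ u hu.2.1
    have hit : ∀ z, ((⇑w)^[n]) z = z + ((⇑w)^[n]) 0 := by
      intro z
      rw [iterate_affine hu.1 n z, hun]
    have hμ := iterate_zero_trans hB hω i hT hx hit
    set μ := ((⇑w)^[n]) 0 with hμdef
    have hu1 : u μ = - μ := by
      rw [hμ, map_smul, h, smul_neg]
    have hu2 : u μ = μ := by
      have e1 : w (((⇑w)^[n]) 0) = ((⇑w)^[n]) (w 0) := by
        exact (Function.iterate_succ_apply' (⇑w) n 0).symm.trans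
          (Function.iterate_succ_apply (⇑w) n 0)
      rw [hit (w 0), ← hμdef, hu.1, add_comm] at e1
      exact add_left_cancel e1
    have hμ0 : μ = 0 := by
      rw [hu2] at hu1
      have h6 : (2 : ℝ) • μ = 0 := by
        rw [two_smul]
        nth_rewrite 1 [hu1]
        exact neg_add_cancel μ
      exact (smul_eq_zero.1 h6).resolve_left two_ne_zero
    obtain ⟨x₀, -, h5⟩ := exists_fixed hu.1 (tubeQ_convex _ _ _) hT hn hx
      (by rw [hit, hμ0, add_zero])
    exact not_hyp_of_fixed h5 h2

lemma eq_one_of_tcoef {Φ : Set (E m)} (hΦ : IsRootSystem Φ) {B ω : Fin m → E m}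
    (hB : IsSimpleSystem Φ B) (hω : IsFundamentalCoweights B ω) (i : Fin m) {x : E m}
    (hx : x ∈ tubeQ Φ (ω i) x) (hne : ω i ≠ 0)
    {w : Equiv.Perm (E m)} (hw : w ∈ dirStab Φ (ω i) (tubeQ Φ (ω i) x))
    (h0 : tcoef (ω i) w = 0) : w = 1 := by
  obtain ⟨x₀, h1, h2⟩ := exists_axis hΦ hB hω i hx hne hw
  rw [h0, zero_smul, add_zero] at h2
  obtain ⟨t, ht⟩ := exists_regular hΦ (tubeQ_sub h1)
  refine eq_one_of_fix_regular hΦ ht hw.1 ?_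
  obtain ⟨u, hu, h⟩ := dirStab_lin hΦ hw
  rw [hu.1, map_add, map_smul, h]
  rw [hu.1] at h2
  calc _ = (u x₀ + w 0) + t • ω i := by abel
    _ = _ := by rw [h2]

lemma hyp_of_tcoef {Φ : Set (E m)} (hΦ : IsRootSystem Φ) {B ω : Fin m → E m}
    (hB : IsSimpleSystem Φ B) (hω : IsFundamentalCoweights B ω) (i : Fin m) {x : E m}
    (hx : x ∈ tubeQ Φ (ω i) x) (hne : ω i ≠ 0)
    {w : Equiv.Perm (E m)} (hw : w ∈ dirStab Φ (ω i) (tubeQ Φ (ω i) x))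
    (h0 : tcoef (ω i) w ≠ 0) : IsHypStab Φ (tubeQ Φ (ω i) x) w ∧
      HasTransVec (w : E m → E m) (tcoef (ω i) w • ω i) := by
  obtain ⟨x₀, h1, h2⟩ := exists_axis hΦ hB hω i hx hne hw
  set c := tcoef (ω i) w with hc
  have hv : c • ω i ≠ 0 := smul_ne_zero h0 hne
  set v := c • ω i with hvdef
  -- the displacement has constant inner product with `v`
  have hin : ∀ y, ⟪w y - y, v⟫ = ⟪v, v⟫ := by
    intro y
    rw [hvdef, real_inner_smul_right, inner_sub_left, inner_dirStab hΦ hne hw,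
      real_inner_smul_right, real_inner_smul_left, ← hc]
    ring
  have hsq : ∀ y, ‖w y - y‖ ^ 2 = ‖w y - y - v‖ ^ 2 + ‖v‖ ^ 2 := by
    intro y
    rw [norm_sub_sq_real (w y - y) v, hin, real_inner_self_eq_norm_sq]
    ring
  have hle : ∀ y, ‖v‖ ≤ dist y (w y) := by
    intro y
    rw [dist_comm, dist_eq_norm]
    refine le_of_sq_le_sq ?_ (norm_nonneg _)
    rw [hsq]
    nlinarith [sq_nonneg ‖w y - y - v‖]
  have hx0 : dist x₀ (w x₀) = ‖v‖ := by
    rw [h2, dist_comm, dist_eq_norm, add_sub_cancel_left]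
  have hmin : minDisp (w : E m → E m) = ‖v‖ := by
    apply le_antisymm
    · rw [← hx0]
      refine ciInf_le ⟨0, ?_⟩ x₀
      rintro _ ⟨y, rfl⟩
      exact dist_nonneg
    · exact le_ciInf hle
  refine ⟨⟨hw.1, ⟨⟨x₀, ?_⟩, ?_⟩, hw.2.1⟩, ?_⟩
  · show dist x₀ (w x₀) = _
    rw [hx0, hmin]
  · rw [hmin]; exact norm_pos_iff.2 hv
  · intro y hy
    have hy' : dist y (w y) = ‖v‖ := by rw [← hmin]; exact hy
    rw [dist_comm, dist_eq_norm] at hy'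
    have := hsq y
    rw [hy'] at this
    have h3 : ‖w y - y - v‖ = 0 := by
      have : ‖w y - y - v‖ ^ 2 = 0 := by linarith
      exact pow_eq_zero_iff (two_ne_zero) |>.1 this
    have h4 := norm_eq_zero.1 h3
    rw [sub_sub, sub_eq_zero] at h4
    exact h4

lemma tcoef_mul {Φ : Set (E m)} (hΦ : IsRootSystem Φ) {β : E m} (hβ : β ≠ 0) {T : Set (E m)}
    {w₁ w₂ : Equiv.Perm (E m)} (h₁ : w₁ ∈ dirStab Φ β T) :
    tcoef β (w₁ * w₂) = tcoef β w₁ + tcoef β w₂ := by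
  have hββ : ⟪β, β⟫ ≠ (0:ℝ) := (inner_self_ne_zero (𝕜 := ℝ)).mpr hβ
  conv_lhs => unfold tcoef
  rw [Equiv.Perm.coe_mul, Function.comp, inner_dirStab hΦ hβ h₁]
  conv_rhs => rw [tcoef.eq_def β w₂]
  field_simp
  ring

lemma tcoef_zpow {Φ : Set (E m)} (hΦ : IsRootSystem Φ) {β : E m} (hβ : β ≠ 0) {T : Set (E m)}
    {w : Equiv.Perm (E m)} (h : w ∈ dirStab Φ β T) (z : ℤ) :
    tcoef β (w ^ z) = z * tcoef β w := by
  let F : dirStab Φ β T →* Multiplicative ℝ :=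
    { toFun := fun g => Multiplicative.ofAdd (tcoef β g.1)
      map_one' := by simp [tcoef]
      map_mul' := fun a b => by
        rw [← ofAdd_add, ← tcoef_mul hΦ hβ a.2]
        rfl }
  have := map_zpow F ⟨w, h⟩ z
  have h2 := congrArg Multiplicative.toAdd this
  simpa [F] using h2

/-- The identity together with the hyperbolic elements of `W^aff`
stabilizing a geodesic tube `𝒯` of direction `β∨ = ω_i∨` forms a cyclic subgroup
of `W^aff`, and the hyperbolic stabilizer `w_min` with minimal positive coefficient
`c_w` (where `v_w = c_w β∨`) is a generator. -/
theorem hyperbolic_stabilizers_cyclic {m : ℕ} (Φ : Set (E m)) (hΦ : IsRootSystem Φ)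
    (B ω : Fin m → E m) (hB : IsSimpleSystem Φ B) (hω : IsFundamentalCoweights B ω)
    (i : Fin m) (T : Set (E m)) (hT : IsGeodesicTube Φ (ω i) T)
    (wmin : Equiv.Perm (E m)) (cmin : ℝ)
    (hwmin : IsHypStab Φ T wmin)
    (hcmin : HasTransVec (wmin : E m → E m) (cmin • ω i)) (hcpos : 0 < cmin)
    (hminimal : ∀ w : Equiv.Perm (E m), IsHypStab Φ T w →
      ∀ c : ℝ, HasTransVec (w : E m → E m) (c • ω i) → 0 < c → cmin ≤ c) :
    ∃ H : Subgroup (Equiv.Perm (E m)),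
      ((H : Set (Equiv.Perm (E m))) = {w | w = 1 ∨ IsHypStab Φ T w}) ∧
      (∀ w : Equiv.Perm (E m), (w = 1 ∨ IsHypStab Φ T w) → ∃ z : ℤ, w = wmin ^ z) := by
  obtain ⟨x, hxw, rfl⟩ := hT
  rw [tube_eq hxw] at *
  have hx := self_mem_tubeQ hxw
  have hne : ω i ≠ 0 := by
    intro h0
    have := hω i i
    rw [h0] at this
    simp at this
  have hββ : ⟪ω i, ω i⟫ ≠ (0:ℝ) := (inner_self_ne_zero (𝕜 := ℝ)).mpr hne
  have hmem : ∀ w : Equiv.Perm (E m), (w = 1 ∨ IsHypStab Φ (tubeQ Φ (ω i) x) w) →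
      w ∈ dirStab Φ (ω i) (tubeQ Φ (ω i) x) := by
    rintro w (rfl | h)
    · exact one_mem _
    · exact mem_dirStab_of_hyp hΦ hB hω i hx h
  refine ⟨dirStab Φ (ω i) (tubeQ Φ (ω i) x), ?_, ?_⟩
  · ext w
    refine ⟨fun h => ?_, fun h => hmem w h⟩
    by_cases h0 : tcoef (ω i) w = 0
    · exact Or.inl (eq_one_of_tcoef hΦ hB hω i hx hne h h0)
    · exact Or.inr (hyp_of_tcoef hΦ hB hω i hx hne h h0).1
  · intro w hw
    have hwm := hmem w hw
    have hm := hmem wmin (Or.inr hwmin)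
    have hc : tcoef (ω i) wmin = cmin := by
      obtain ⟨y, hy⟩ := hwmin.2.1.1
      have h1 := hcmin y hy
      have h2 := inner_dirStab hΦ hne hm y
      rw [h1, inner_add_left, real_inner_smul_left] at h2
      exact (mul_right_cancel₀ hββ (add_left_cancel h2)).symm
    set q : ℤ := ⌊tcoef (ω i) w / cmin⌋ with hq
    refine ⟨q, ?_⟩
    have hg : w * wmin ^ (-q) ∈ dirStab Φ (ω i) (tubeQ Φ (ω i) x) :=
      mul_mem hwm (zpow_mem hm _)
    have hgc : tcoef (ω i) (w * wmin ^ (-q)) = tcoef (ω i) w - q * cmin := by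
      rw [tcoef_mul hΦ hne hwm, tcoef_zpow hΦ hne hm, hc]
      push_cast
      ring
    have hlo : 0 ≤ tcoef (ω i) w - q * cmin := by
      have := Int.floor_le (tcoef (ω i) w / cmin)
      rw [le_div_iff₀ hcpos] at this
      linarith
    have hhi : tcoef (ω i) w - q * cmin < cmin := by
      have := Int.lt_floor_add_one (tcoef (ω i) w / cmin)
      rw [div_lt_iff₀ hcpos, ← hq] at this
      linarith
    have h0 : tcoef (ω i) (w * wmin ^ (-q)) = 0 := by
      by_contra hn0
      obtain ⟨h1, h2⟩ := hyp_of_tcoef hΦ hB hω i hx hne hg hn0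
      have h3 := hminimal _ h1 _ h2 (lt_of_le_of_ne (by rw [hgc]; exact hlo) (Ne.symm hn0))
      rw [hgc] at h3
      linarith
    have h1 := eq_one_of_tcoef hΦ hB hω i hx hne hg h0
    rw [zpow_neg] at h1
    exact mul_inv_eq_one.1 h1


end
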